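/- Let R, A₁, A₂ be nonempty finite types with d₁ = |A₁|, d₂ = |A₂|, d₁·d₂ ≥ 2, and set A = A₁ × A₂. Let ρ : Matrix (R × A) (R × A) ℂ be positive semidefinite. For U ∈ Matrix.unitaryGroup A ℂ let ρ(U) = (1_R ⊗ U) · ρ · (1_R ⊗ U)ᴴ, where 1_R ⊗ U is the Kronecker product of the identity on R with U, and let σ(U) : Matrix ((R × A₂)) ((R × A₂)) ℂ be the partial trace of ρ(U) over A₁. Let ρ_R be the partial trace of ρ over A. Then ∫ U, trace(σ(U) · σ(U)) dμ ≤ (1/d₂) · trace(ρ_R · ρ_R) + (1/d₁) · trace(ρ · ρ), where μ is the Haar probability measure on Matrix.unitaryGroup A ℂ. -/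

import Mathlib

open MeasureTheory Matrix
open scoped Kronecker ComplexOrder

noncomputable section

local instance {A : Type*} [Fintype A] [DecidableEq A] :
    MeasurableSpace (Matrix.unitaryGroup A ℂ) := borel _

/-- Partial trace over the middle factor `A₁` of a matrix on `R × (A₁ × A₂)`. -/
def ptraceA₁ {R A₁ A₂ : Type*} [Fintype A₁]
    (M : Matrix (R × (A₁ × A₂)) (R × (A₁ × A₂)) ℂ) :
    Matrix (R × A₂) (R × A₂) ℂ :=
  Matrix.of fun p q => ∑ a₁ : A₁, M (p.1, (a₁, p.2)) (q.1, (a₁, q.2))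

/-- Partial trace over the second factor `A` of a matrix on `R × A`. -/
def ptraceA {R A : Type*} [Fintype A]
    (M : Matrix (R × A) (R × A) ℂ) : Matrix R R ℂ :=
  Matrix.of fun r r' => ∑ a : A, M (r, a) (r', a)

lemma apb_compact {A : Type*} [Fintype A] [DecidableEq A] :
    CompactSpace (Matrix.unitaryGroup A ℂ) := by
  have h1 : IsCompact (Set.pi Set.univ fun _ : A => Set.pi Set.univ fun _ : A =>
      Metric.closedBall (0 : ℂ) 1) :=
    isCompact_univ_pi fun _ => isCompact_univ_pi fun _ => isCompact_closedBall _ _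
  have h2 : IsClosed {U : Matrix A A ℂ | U * star U = 1} :=
    isClosed_eq (by fun_prop) continuous_const
  have h3 : ((Matrix.unitaryGroup A ℂ : Submonoid (Matrix A A ℂ)) : Set (Matrix A A ℂ)) =
      {U : Matrix A A ℂ | U * star U = 1} := by
    ext U
    simp [Matrix.mem_unitaryGroup_iff]
  have h4 : IsCompact ((Matrix.unitaryGroup A ℂ : Submonoid (Matrix A A ℂ)) :
      Set (Matrix A A ℂ)) := by
    refine IsCompact.of_isClosed_subset h1 (h3 ▸ h2) ?_
    intro U hU
    refine fun i _ j _ => mem_closedBall_zero_iff.mpr ?_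
    exact entry_norm_bound_of_unitary hU i j
  exact isCompact_iff_compactSpace.mp h4

lemma apb_right {A : Type*} [Fintype A] [DecidableEq A]
    (μ : Measure (Matrix.unitaryGroup A ℂ))
    [μ.IsHaarMeasure] [IsProbabilityMeasure μ] : μ.IsMulRightInvariant := by
  have : BorelSpace (Matrix.unitaryGroup A ℂ) := ⟨rfl⟩
  have : CompactSpace (Matrix.unitaryGroup A ℂ) := apb_compact
  refine ⟨fun g => ?_⟩
  have : IsProbabilityMeasure (Measure.map (· * g) μ) :=
    Measure.isProbabilityMeasure_map (continuous_mul_const g).measurable.aemeasurable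
  exact Measure.isHaarMeasure_eq_of_isProbabilityMeasure _ _

lemma apb_integrable {A : Type*} [Fintype A] [DecidableEq A]
    (μ : Measure (Matrix.unitaryGroup A ℂ)) [IsProbabilityMeasure μ]
    (f : Matrix.unitaryGroup A ℂ → ℂ) (hf : Continuous f) : Integrable f μ := by
  have : BorelSpace (Matrix.unitaryGroup A ℂ) := ⟨rfl⟩
  have : CompactSpace (Matrix.unitaryGroup A ℂ) := apb_compact
  have := hf.continuousOn (s := Set.univ) |>.integrableOn_compact (μ := μ) isCompact_univ
  simpa using this

/-- the diagonal phase unitary -/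
lemma apb_diag {A : Type*} [Fintype A] [DecidableEq A] (z : A → ℂ) (hz : ∀ a, ‖z a‖ = 1) :
    Matrix.diagonal z ∈ Matrix.unitaryGroup A ℂ := by
  rw [Matrix.mem_unitaryGroup_iff, Matrix.star_eq_conjTranspose, Matrix.diagonal_conjTranspose,
    Matrix.diagonal_mul_diagonal, ← Matrix.diagonal_one]
  congr 1
  ext a
  simp [Complex.mul_conj, Complex.normSq_eq_norm_sq, hz]

/-- the entries of `V ⊗ V` applied on both sides -/
lemma apb_comm {A : Type*} [Fintype A] [DecidableEq A] (X : Matrix (A × A) (A × A) ℂ)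
    (V : Matrix A A ℂ) (h : (V ⊗ₖ V) * X = X * (V ⊗ₖ V)) (a b c d : A) :
    ∑ e, ∑ f, V a e * V b f * X (e, f) (c, d) = ∑ e, ∑ f, X (a, b) (e, f) * (V e c * V f d) := by
  have := congrFun (congrFun h (a, b)) (c, d)
  simpa [Matrix.mul_apply, Fintype.sum_prod_type] using this

lemma apb_commutant {A : Type*} [Fintype A] [DecidableEq A] [Nontrivial A]
    (X : Matrix (A × A) (A × A) ℂ)
    (h : ∀ V ∈ Matrix.unitaryGroup A ℂ, (V ⊗ₖ V) * X = X * (V ⊗ₖ V)) :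
    ∃ β γ : ℂ, ∀ a b c d, X (a, b) (c, d) =
      (if a = c ∧ b = d then β else 0) + (if a = d ∧ b = c then γ else 0) := by
  -- diagonal phases
  have hdiag : ∀ z : A → ℂ, (∀ a, ‖z a‖ = 1) → ∀ a b c d,
      z a * z b * X (a, b) (c, d) = X (a, b) (c, d) * (z c * z d) := by
    intro z hz a b c d
    have := apb_comm X _ (h _ (apb_diag z hz)) a b c d
    simpa [Matrix.diagonal_apply] using this
  have hzero : ∀ a b c d, ¬ (a = c ∧ b = d) → ¬ (a = d ∧ b = c) → X (a, b) (c, d) = 0 := by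
    intro a b c d h1 h2
    -- phase `I` at one suitable point
    have key : ∀ w : A, (if a = w then Complex.I else 1) * (if b = w then Complex.I else 1) *
        X (a, b) (c, d) = X (a, b) (c, d) *
          ((if c = w then Complex.I else 1) * (if d = w then Complex.I else 1)) := by
      intro w
      exact hdiag (fun x => if x = w then Complex.I else 1)
        (fun x => by by_cases hx : x = w <;> simp [hx]) a b c d
    by_contra hX
    have key2 : ∀ w : A, (if a = w then Complex.I else 1) * (if b = w then Complex.I else 1) =
          ((if c = w then Complex.I else 1) * (if d = w then Complex.I else 1)) := by
      intro w
      have := key w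
      rw [mul_comm] at this
      exact mul_left_cancel₀ hX this
    have hI : (Complex.I) ≠ 1 := fun h => by simpa using congrArg Complex.re h
    have hI2 : (1 : ℂ) ≠ Complex.I := hI.symm
    have hI3 : (-1 : ℂ) ≠ 1 := by norm_num
    have hI4 : (-1 : ℂ) ≠ Complex.I := fun h => by simpa using congrArg Complex.re h
    have ka := key2 a
    have kb := key2 b
    by_cases hab : a = b <;> by_cases hac : a = c <;> by_cases had : a = d <;>
      by_cases hbc : b = c <;> by_cases hbd : b = d <;>
      simp_all [eq_comm]
  -- permutations
  have hperm : ∀ (σ : Equiv.Perm A) a b c d,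
      X (σ a, σ b) (σ c, σ d) = X (a, b) (c, d) := by
    intro σ a b c d
    have hm : (Matrix.of fun i j => if j = σ i then (1 : ℂ) else 0) ∈ Matrix.unitaryGroup A ℂ := by
      rw [Matrix.mem_unitaryGroup_iff]
      ext i j
      simp [Matrix.mul_apply, Matrix.one_apply, eq_comm]
    have := apb_comm X _ (h _ hm) a b (σ c) (σ d)
    have e1 : ∀ x y : A, (y = σ b ∧ x = σ a) ↔ (x = σ a ∧ y = σ b) := fun _ _ => and_comm
    have e2 : ∀ x y : A, (d = y ∧ c = x) ↔ (c = x ∧ d = y) := fun _ _ => and_comm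
    simpa [← ite_and, e1, e2, ite_and] using this
  -- rotations
  have hrot : ∀ i j, i ≠ j → X (i, i) (i, i) = X (i, j) (i, j) + X (j, i) (i, j) := by
    intro i j hij
    set s : ℂ := (((Real.sqrt 2)⁻¹ : ℝ) : ℂ) with hs
    have hss : s * s = 1 / 2 := by
      rw [hs, ← Complex.ofReal_mul, ← mul_inv, Real.mul_self_sqrt (by norm_num)]
      norm_num
    have hs0 : s ≠ 0 := by intro h0; rw [h0] at hss; norm_num at hss
    have hsc : (starRingEnd ℂ) s = s := Complex.conj_ofReal _
    let V : Matrix A A ℂ := Matrix.of fun a b =>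
      if a = i then (if b = i then s else if b = j then s else 0)
      else if a = j then (if b = i then s else if b = j then -s else 0)
      else if a = b then 1 else 0
    have hsum : ∀ g : A → ℂ, (∀ e, e ≠ i → e ≠ j → g e = 0) → ∑ e, g e = g i + g j := by
      intro g hg
      rw [← Finset.sum_pair hij]
      symm
      apply Finset.sum_subset (Finset.subset_univ _)
      intro x _ hx
      simp only [Finset.mem_insert, Finset.mem_singleton, not_or] at hx
      exact hg x hx.1 hx.2
    have hm : V ∈ Matrix.unitaryGroup A ℂ := by
      rw [Matrix.mem_unitaryGroup_iff]
      ext a b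
      rw [Matrix.mul_apply]
      simp only [Matrix.star_apply]
      by_cases ha : a = i ∨ a = j
      · rw [hsum _ (by intro e h1 h2; rcases ha with rfl | rfl <;> simp [V, h1, h2])]
        rcases ha with rfl | rfl
        · by_cases hb : b = a
          · subst hb; simp [V, hij.symm, hsc, hss]; norm_num
          · by_cases hb2 : b = j
            · subst hb2; simp [V, hij, hij.symm, hsc, hss]
            · simp [V, hb, hb2, hij.symm, hsc, hss, Ne.symm hb]
        · by_cases hb : b = a
          · subst hb; simp [V, hij.symm, hsc, hss]; norm_num
          · by_cases hb2 : b = i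
            · subst hb2; simp [V, hij, hij.symm, hsc, hss]
            · simp [V, hb, hb2, hij.symm, hsc, hss, Ne.symm hb]
      · push Not at ha
        rw [Finset.sum_eq_single a]
        · by_cases hb : b = i
          · subst hb; simp [V, ha.1, ha.2]
          · by_cases hb2 : b = j
            · subst hb2; simp [V, ha.1, ha.2, hb]
            · by_cases hab : a = b
              · subst hab; simp [V, ha.1, ha.2]
              · simp [V, ha.1, ha.2, hb, hb2, hab, Ne.symm hab]
        · intro e _ he; simp [V, ha.1, ha.2, he.symm]
        · simp
    have := apb_comm X _ (h _ hm) i i i j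
    have hL : ∑ e, ∑ f, V i e * V i f * X (e, f) (i, j) =
        s * s * (X (i, j) (i, j) + X (j, i) (i, j)) := by
      rw [hsum _ (by intro e h1 h2; simp [V, h1, h2]),
        hsum _ (by intro e h1 h2; simp [V, h1, h2]),
        hsum _ (by intro e h1 h2; simp [V, h1, h2])]
      rw [hzero i i i j (by simp [hij]) (by simp [hij]), hzero j j i j (by simp [hij.symm])
        (by simp [hij.symm])]
      simp [V, hij.symm]
      ring
    have hR : ∑ e, ∑ f, X (i, i) (e, f) * (V e i * V f j) = s * s * X (i, i) (i, i) := by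
      rw [Finset.sum_eq_single i, Finset.sum_eq_single i]
      · simp [V, hij.symm]; ring
      · intro e _ he
        rw [hzero i i i e (by simp [he.symm]) (by simp [he.symm]), zero_mul]
      · simp
      · intro e _ he
        apply Finset.sum_eq_zero
        intro f _
        rw [hzero i i e f (by simp [he.symm]) (by simp [he.symm]), zero_mul]
      · simp
    rw [hL, hR] at this
    exact (mul_left_cancel₀ (mul_ne_zero hs0 hs0) this).symm
  obtain ⟨i, j, hij⟩ := exists_pair_ne A
  have htrans : ∀ k l, k ≠ l → ∃ σ : Equiv.Perm A, σ i = k ∧ σ j = l := by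
    intro k l hkl
    refine ⟨Equiv.swap (Equiv.swap i k j) l * Equiv.swap i k, ?_, ?_⟩
    · have : k ≠ Equiv.swap i k j := by
        intro hk
        have h2 : Equiv.swap i k i = Equiv.swap i k j := by rw [Equiv.swap_apply_left]; exact hk
        exact hij ((Equiv.swap i k).injective h2)
      simp [Equiv.swap_apply_of_ne_of_ne this hkl]
    · simp
  have hb : ∀ k l, k ≠ l → X (k, l) (k, l) = X (i, j) (i, j) := by
    intro k l hkl
    obtain ⟨σ, rfl, rfl⟩ := htrans k l hkl
    exact hperm σ _ _ _ _
  have hc : ∀ k l, k ≠ l → X (l, k) (k, l) = X (j, i) (i, j) := by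
    intro k l hkl
    obtain ⟨σ, rfl, rfl⟩ := htrans k l hkl
    exact hperm σ _ _ _ _
  refine ⟨X (i, j) (i, j), X (j, i) (i, j), ?_⟩
  intro a b c d
  by_cases h1 : a = c ∧ b = d
  · obtain ⟨rfl, rfl⟩ := h1
    by_cases hab : a = b
    · subst hab
      obtain ⟨l, hl⟩ := exists_ne a
      rw [hrot a l hl.symm, hb a l hl.symm, hc a l hl.symm]
      simp
    · simp [hab, hb a b hab]
  · by_cases h2 : a = d ∧ b = c
    · obtain ⟨rfl, rfl⟩ := h2
      have hab : b ≠ a := by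
        rintro rfl; simp at h1
      simp [hc b a hab, h1]
    · simp [h1, h2, hzero a b c d h1 h2]

lemma apb_reorder {R Y Z A : Type*} [Fintype R] [Fintype Y] [Fintype Z] [Fintype A]
    (F : R → Y → R → Y → Z → A → A → Z → A → A → ℂ) :
    ∑ r, ∑ y, ∑ s, ∑ y', ∑ x, ∑ a, ∑ a', ∑ x', ∑ b, ∑ b', F r y s y' x a a' x' b b' =
    ∑ t : R × R × A × A × A × A, ∑ x, ∑ x', ∑ y, ∑ y',
      F t.1 y t.2.1 y' x t.2.2.1 t.2.2.2.1 x' t.2.2.2.2.1 t.2.2.2.2.2 := by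
  have h1 : ∑ r, ∑ y, ∑ s, ∑ y', ∑ x, ∑ a, ∑ a', ∑ x', ∑ b, ∑ b', F r y s y' x a a' x' b b' =
      ∑ t : R × Y × R × Y × Z × A × A × Z × A × A, F t.1 t.2.1 t.2.2.1 t.2.2.2.1 t.2.2.2.2.1
        t.2.2.2.2.2.1 t.2.2.2.2.2.2.1 t.2.2.2.2.2.2.2.1 t.2.2.2.2.2.2.2.2.1
        t.2.2.2.2.2.2.2.2.2 := by
    simp only [Fintype.sum_prod_type]
  have h2 : ∑ t : R × R × A × A × A × A, ∑ x, ∑ x', ∑ y, ∑ y',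
      F t.1 y t.2.1 y' x t.2.2.1 t.2.2.2.1 x' t.2.2.2.2.1 t.2.2.2.2.2 =
      ∑ t : (R × R × A × A × A × A) × (Z × Z × Y × Y), F t.1.1 t.2.2.2.1 t.1.2.1 t.2.2.2.2 t.2.1
        t.1.2.2.1 t.1.2.2.2.1 t.2.2.1 t.1.2.2.2.2.1 t.1.2.2.2.2.2 := by
    simp only [Fintype.sum_prod_type]
  rw [h1, h2]
  refine Fintype.sum_equiv
    { toFun := fun ⟨r, y, s, y', x, a, a', x', b, b'⟩ => ((r, s, a, a', b, b'), (x, x', y, y'))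
      invFun := fun ⟨⟨r, s, a, a', b, b'⟩, ⟨x, x', y, y'⟩⟩ => (r, y, s, y', x, a, a', x', b, b')
      left_inv := fun _ => rfl
      right_inv := fun _ => rfl } _ _ (fun _ => rfl)

/-- The operator `1_{A₁A₁} ⊗ F_{A₂A₂}`. -/
def apbW (A₁ A₂ : Type*) [Fintype A₁] [Fintype A₂] [DecidableEq A₁] [DecidableEq A₂] :
    Matrix ((A₁ × A₂) × (A₁ × A₂)) ((A₁ × A₂) × (A₁ × A₂)) ℂ :=
  ∑ x : A₁, ∑ x' : A₁, ∑ y : A₂, ∑ y' : A₂,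
    Matrix.single ((x, y'), (x', y)) ((x, y), (x', y')) 1

/-- The twirled operator. -/
def apbG {A₁ A₂ : Type*} [Fintype A₁] [Fintype A₂] [DecidableEq A₁] [DecidableEq A₂]
    (U : Matrix (A₁ × A₂) (A₁ × A₂) ℂ) :
    Matrix ((A₁ × A₂) × (A₁ × A₂)) ((A₁ × A₂) × (A₁ × A₂)) ℂ :=
  (U ⊗ₖ U)ᴴ * apbW A₁ A₂ * (U ⊗ₖ U)

/-- The swap operator. -/
def apbF (A : Type*) [DecidableEq A] : Matrix (A × A) (A × A) ℂ :=
  Matrix.of fun p q => if q = p.swap then 1 else 0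

lemma apbG_apply {A₁ A₂ : Type*} [Fintype A₁] [Fintype A₂] [DecidableEq A₁] [DecidableEq A₂]
    (U : Matrix (A₁ × A₂) (A₁ × A₂) ℂ) (a' b' a b : A₁ × A₂) :
    apbG U (a', b') (a, b) = ∑ x : A₁, ∑ x' : A₁, ∑ y : A₂, ∑ y' : A₂,
      star (U (x, y') a') * star (U (x', y) b') * (U (x, y) a * U (x', y') b) := by
  unfold apbG apbW
  simp only [Matrix.mul_sum, Matrix.sum_mul, Matrix.sum_apply]
  refine Finset.sum_congr rfl fun x _ => Finset.sum_congr rfl fun x' _ =>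
    Finset.sum_congr rfl fun y _ => Finset.sum_congr rfl fun y' _ => ?_
  rw [Matrix.mul_apply, Finset.sum_eq_single ((x, y), (x', y'))]
  · rw [Matrix.mul_single_apply_same]
    simp [Matrix.conjTranspose_apply]
  · intro p _ hp
    rw [Matrix.mul_single_apply_of_ne _ _ _ _ _ hp, zero_mul]
  · simp

lemma apb_entry {R A₁ A₂ : Type*} [Fintype R] [Fintype A₁] [Fintype A₂]
    [DecidableEq R] [DecidableEq A₁] [DecidableEq A₂]
    (ρ : Matrix (R × (A₁ × A₂)) (R × (A₁ × A₂)) ℂ)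
    (U : Matrix (A₁ × A₂) (A₁ × A₂) ℂ) (r s : R) (y y' : A₂) :
    ptraceA₁ (((1 : Matrix R R ℂ) ⊗ₖ U) * ρ * ((1 : Matrix R R ℂ) ⊗ₖ U)ᴴ) (r, y) (s, y') =
      ∑ x : A₁, ∑ a : A₁ × A₂, ∑ a' : A₁ × A₂,
        U (x, y) a * ρ (r, a) (s, a') * star (U (x, y') a') := by
  unfold ptraceA₁
  simp only [Matrix.of_apply]
  refine Finset.sum_congr rfl fun x _ => ?_
  rw [Finset.sum_comm, Matrix.mul_apply, Fintype.sum_prod_type, Finset.sum_eq_single s]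
  · refine Finset.sum_congr rfl fun a' _ => ?_
    rw [Matrix.mul_apply, Fintype.sum_prod_type, Finset.sum_eq_single r, Finset.sum_mul]
    · simp [Matrix.kroneckerMap_apply]
    · intro t _ ht
      simp [Matrix.kroneckerMap_apply, Matrix.one_apply, ht.symm]
    · simp
  · intro t _ ht
    simp [Matrix.kroneckerMap_apply, Matrix.one_apply, ht.symm]
  · simp

lemma apb_trace {R A₁ A₂ : Type*} [Fintype R] [Fintype A₁] [Fintype A₂]
    [DecidableEq R] [DecidableEq A₁] [DecidableEq A₂]
    (ρ : Matrix (R × (A₁ × A₂)) (R × (A₁ × A₂)) ℂ)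
    (U : Matrix (A₁ × A₂) (A₁ × A₂) ℂ) :
    (ptraceA₁ (((1 : Matrix R R ℂ) ⊗ₖ U) * ρ * ((1 : Matrix R R ℂ) ⊗ₖ U)ᴴ) *
      ptraceA₁ (((1 : Matrix R R ℂ) ⊗ₖ U) * ρ * ((1 : Matrix R R ℂ) ⊗ₖ U)ᴴ)).trace =
    ∑ t : R × R × (A₁ × A₂) × (A₁ × A₂) × (A₁ × A₂) × (A₁ × A₂),
      ρ (t.1, t.2.2.1) (t.2.1, t.2.2.2.1) * ρ (t.2.1, t.2.2.2.2.1) (t.1, t.2.2.2.2.2) *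
      apbG U (t.2.2.2.1, t.2.2.2.2.2) (t.2.2.1, t.2.2.2.2.1) := by
  have h1 : (ptraceA₁ (((1 : Matrix R R ℂ) ⊗ₖ U) * ρ * ((1 : Matrix R R ℂ) ⊗ₖ U)ᴴ) *
      ptraceA₁ (((1 : Matrix R R ℂ) ⊗ₖ U) * ρ * ((1 : Matrix R R ℂ) ⊗ₖ U)ᴴ)).trace =
      ∑ r : R, ∑ y : A₂, ∑ s : R, ∑ y' : A₂, ∑ x : A₁, ∑ a : A₁ × A₂, ∑ a' : A₁ × A₂,
        ∑ x' : A₁, ∑ b : A₁ × A₂, ∑ b' : A₁ × A₂,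
        (U (x, y) a * ρ (r, a) (s, a') * star (U (x, y') a')) *
        (U (x', y') b * ρ (s, b) (r, b') * star (U (x', y) b')) := by
    rw [Matrix.trace, Fintype.sum_prod_type]
    refine Finset.sum_congr rfl fun r _ => Finset.sum_congr rfl fun y _ => ?_
    rw [Matrix.diag_apply, Matrix.mul_apply, Fintype.sum_prod_type]
    refine Finset.sum_congr rfl fun s _ => Finset.sum_congr rfl fun y' _ => ?_
    rw [apb_entry, apb_entry]
    simp only [Finset.sum_mul]
    simp only [Finset.mul_sum]
  rw [h1, apb_reorder]
  refine Finset.sum_congr rfl fun t _ => ?_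
  rw [apbG_apply]
  simp only [Finset.mul_sum]
  refine Finset.sum_congr rfl fun x _ => Finset.sum_congr rfl fun x' _ =>
    Finset.sum_congr rfl fun y _ => Finset.sum_congr rfl fun y' _ => ?_
  ring

lemma apbG_continuous {A₁ A₂ : Type*} [Fintype A₁] [Fintype A₂] [DecidableEq A₁] [DecidableEq A₂]
    (p q : (A₁ × A₂) × (A₁ × A₂)) :
    Continuous fun U : Matrix.unitaryGroup (A₁ × A₂) ℂ =>
      apbG (U : Matrix (A₁ × A₂) (A₁ × A₂) ℂ) p q := by
  obtain ⟨a', b'⟩ := p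
  obtain ⟨a, b⟩ := q
  simp only [apbG_apply]
  have h : ∀ i j, Continuous fun U : Matrix.unitaryGroup (A₁ × A₂) ℂ =>
      (U : Matrix (A₁ × A₂) (A₁ × A₂) ℂ) i j :=
    fun i j => continuous_subtype_val.matrix_elem i j
  refine continuous_finsetSum _ fun x _ => continuous_finsetSum _ fun x' _ =>
    continuous_finsetSum _ fun y _ => continuous_finsetSum _ fun y' _ => ?_
  exact ((h _ _).star.mul (h _ _).star).mul ((h _ _).mul (h _ _))

/-- The averaged twirled operator. -/
def apbX {A₁ A₂ : Type*} [Fintype A₁] [Fintype A₂] [DecidableEq A₁] [DecidableEq A₂]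
    (μ : Measure (Matrix.unitaryGroup (A₁ × A₂) ℂ)) :
    Matrix ((A₁ × A₂) × (A₁ × A₂)) ((A₁ × A₂) × (A₁ × A₂)) ℂ :=
  Matrix.of fun p q => ∫ U : Matrix.unitaryGroup (A₁ × A₂) ℂ,
    apbG (U : Matrix (A₁ × A₂) (A₁ × A₂) ℂ) p q ∂μ

lemma apbX_sandwich {A₁ A₂ : Type*} [Fintype A₁] [Fintype A₂] [DecidableEq A₁] [DecidableEq A₂]
    (μ : Measure (Matrix.unitaryGroup (A₁ × A₂) ℂ)) [IsProbabilityMeasure μ]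
    (L M : Matrix ((A₁ × A₂) × (A₁ × A₂)) ((A₁ × A₂) × (A₁ × A₂)) ℂ)
    (p q : (A₁ × A₂) × (A₁ × A₂)) :
    ∫ U : Matrix.unitaryGroup (A₁ × A₂) ℂ,
      (L * apbG (U : Matrix (A₁ × A₂) (A₁ × A₂) ℂ) * M) p q ∂μ = (L * apbX μ * M) p q := by
  have hi : ∀ i j, Integrable (fun U : Matrix.unitaryGroup (A₁ × A₂) ℂ =>
      apbG (U : Matrix (A₁ × A₂) (A₁ × A₂) ℂ) i j) μ :=
    fun i j => apb_integrable μ _ (apbG_continuous i j)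
  simp only [Matrix.mul_apply, Finset.sum_mul]
  rw [integral_finsetSum _ fun i _ => integrable_finsetSum _ fun j _ =>
    ((hi _ _).const_mul _).mul_const _]
  refine Finset.sum_congr rfl fun i _ => ?_
  rw [integral_finsetSum _ fun j _ => ((hi _ _).const_mul _).mul_const _]
  refine Finset.sum_congr rfl fun j _ => ?_
  rw [integral_mul_const, integral_const_mul]
  rfl

lemma apb_kron_unitary {A : Type*} [Fintype A] [DecidableEq A] (V : Matrix A A ℂ)
    (hV : V ∈ Matrix.unitaryGroup A ℂ) : (V ⊗ₖ V) * (V ⊗ₖ V)ᴴ = 1 := by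
  rw [Matrix.conjTranspose_kronecker, ← Matrix.mul_kronecker_mul]
  have := Matrix.mem_unitaryGroup_iff.mp hV
  rw [Matrix.star_eq_conjTranspose] at this
  rw [this, Matrix.one_kronecker_one]

lemma apbX_comm {A₁ A₂ : Type*} [Fintype A₁] [Fintype A₂] [DecidableEq A₁] [DecidableEq A₂]
    (μ : Measure (Matrix.unitaryGroup (A₁ × A₂) ℂ)) [μ.IsHaarMeasure] [IsProbabilityMeasure μ]
    (V : Matrix (A₁ × A₂) (A₁ × A₂) ℂ) (hV : V ∈ Matrix.unitaryGroup (A₁ × A₂) ℂ) :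
    (V ⊗ₖ V) * apbX μ = apbX μ * (V ⊗ₖ V) := by
  have : BorelSpace (Matrix.unitaryGroup (A₁ × A₂) ℂ) := ⟨rfl⟩
  have := apb_right μ
  have h : (V ⊗ₖ V)ᴴ * apbX μ * (V ⊗ₖ V) = apbX μ := by
    ext p q
    rw [← apbX_sandwich]
    have := integral_mul_right_eq_self (μ := μ)
      (fun U : Matrix.unitaryGroup (A₁ × A₂) ℂ =>
        apbG (U : Matrix (A₁ × A₂) (A₁ × A₂) ℂ) p q) ⟨V, hV⟩
    refine Eq.trans ?_ this
    refine integral_congr_ae (Filter.Eventually.of_forall fun U => ?_)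
    simp only [apbG, Submonoid.coe_mul, Matrix.mul_kronecker_mul, Matrix.conjTranspose_mul,
      Matrix.mul_assoc]
  conv_lhs => rw [← h]
  rw [← Matrix.mul_assoc, ← Matrix.mul_assoc, apb_kron_unitary V hV, Matrix.one_mul]

lemma apbF_kron {A : Type*} [Fintype A] [DecidableEq A] (V : Matrix A A ℂ) :
    (V ⊗ₖ V) * apbF A = apbF A * (V ⊗ₖ V) := by
  ext ⟨a, b⟩ ⟨c, d⟩
  rw [Matrix.mul_apply, Matrix.mul_apply, Finset.sum_eq_single (d, c),
    Finset.sum_eq_single (b, a)]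
  · simp [apbF, mul_comm]
  · intro p _ hp
    simp [apbF, hp]
  · simp
  · rintro ⟨e, f⟩ _ hp
    have : ¬ (c = f ∧ d = e) := fun h => hp (by rw [h.1, h.2])
    simp [apbF, this]
  · simp

lemma apbX_trace {A₁ A₂ : Type*} [Fintype A₁] [Fintype A₂] [DecidableEq A₁] [DecidableEq A₂]
    (μ : Measure (Matrix.unitaryGroup (A₁ × A₂) ℂ)) [IsProbabilityMeasure μ]
    (L : Matrix ((A₁ × A₂) × (A₁ × A₂)) ((A₁ × A₂) × (A₁ × A₂)) ℂ)
    (hL : ∀ V : Matrix (A₁ × A₂) (A₁ × A₂) ℂ, (V ⊗ₖ V) * L = L * (V ⊗ₖ V)) :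
    (L * apbX μ).trace = (L * apbW A₁ A₂).trace := by
  have hi : ∀ i j, Integrable (fun U : Matrix.unitaryGroup (A₁ × A₂) ℂ =>
      (L * apbG (U : Matrix (A₁ × A₂) (A₁ × A₂) ℂ) *
        (1 : Matrix ((A₁ × A₂) × (A₁ × A₂)) ((A₁ × A₂) × (A₁ × A₂)) ℂ)) i j) μ := by
    intro i j
    have he : (fun U : Matrix.unitaryGroup (A₁ × A₂) ℂ =>
        (L * apbG (U : Matrix (A₁ × A₂) (A₁ × A₂) ℂ) *
        (1 : Matrix ((A₁ × A₂) × (A₁ × A₂)) ((A₁ × A₂) × (A₁ × A₂)) ℂ)) i j) =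
        fun U : Matrix.unitaryGroup (A₁ × A₂) ℂ =>
          ∑ k, L i k * apbG (U : Matrix (A₁ × A₂) (A₁ × A₂) ℂ) k j := by
      funext U
      rw [Matrix.mul_one, Matrix.mul_apply]
    rw [he]
    exact integrable_finsetSum _ fun k _ =>
      (apb_integrable μ _ (apbG_continuous k j)).const_mul _
  have h1 : (L * apbX μ).trace = ∫ U : Matrix.unitaryGroup (A₁ × A₂) ℂ,
      (L * apbG (U : Matrix (A₁ × A₂) (A₁ × A₂) ℂ) *
        (1 : Matrix ((A₁ × A₂) × (A₁ × A₂)) ((A₁ × A₂) × (A₁ × A₂)) ℂ)).trace ∂μ := by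
    simp only [Matrix.trace, Matrix.diag_apply]
    rw [integral_finsetSum _ fun i _ => hi i i]
    simp only [apbX_sandwich]
    simp only [Matrix.mul_one]
  have h2 : ∀ U : Matrix.unitaryGroup (A₁ × A₂) ℂ,
      (L * apbG (U : Matrix (A₁ × A₂) (A₁ × A₂) ℂ) *
        (1 : Matrix ((A₁ × A₂) × (A₁ × A₂)) ((A₁ × A₂) × (A₁ × A₂)) ℂ)).trace = (L * apbW A₁ A₂).trace := by
    intro U
    rw [Matrix.mul_one, apbG, ← Matrix.mul_assoc, Matrix.trace_mul_comm, ← Matrix.mul_assoc,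
      ← Matrix.mul_assoc, hL, Matrix.mul_assoc L, apb_kron_unitary _ U.2, Matrix.mul_one]
  rw [h1]
  simp only [h2]
  simp

lemma apbW_trace (A₁ A₂ : Type*) [Fintype A₁] [Fintype A₂] [DecidableEq A₁] [DecidableEq A₂] :
    (1 * apbW A₁ A₂).trace =
      (Fintype.card A₁ : ℂ) * Fintype.card A₁ * Fintype.card A₂ := by
  rw [Matrix.one_mul]
  unfold apbW
  simp only [Matrix.trace_sum]
  have : ∀ (x x' : A₁) (y y' : A₂), (Matrix.single ((x, y'), (x', y)) ((x, y), (x', y'))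
      (1 : ℂ)).trace = if y = y' then 1 else 0 := by
    intro x x' y y'
    split_ifs with h
    · subst h; simp
    · rw [Matrix.trace_single_eq_of_ne]
      intro h2
      simp [h] at h2
  simp [this]
  ring

lemma apbFW_trace (A₁ A₂ : Type*) [Fintype A₁] [Fintype A₂] [DecidableEq A₁] [DecidableEq A₂] :
    (apbF (A₁ × A₂) * apbW A₁ A₂).trace =
      (Fintype.card A₁ : ℂ) * Fintype.card A₂ * Fintype.card A₂ := by
  unfold apbW
  simp only [Matrix.mul_sum, Matrix.trace_sum]
  have : ∀ (x x' : A₁) (y y' : A₂), (apbF (A₁ × A₂) *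
      Matrix.single ((x, y'), (x', y)) ((x, y), (x', y')) (1 : ℂ)).trace =
      if x = x' then 1 else 0 := by
    intro x x' y y'
    rw [Matrix.trace, Finset.sum_eq_single ((x, y), (x', y'))]
    · rw [Matrix.diag_apply, Matrix.mul_single_apply_same]
      simp only [apbF, Matrix.of_apply, Prod.swap_prod_mk, Prod.mk.injEq, and_true, mul_one]
      congr 1
      simp [eq_comm]
    · intro p _ hp
      rw [Matrix.diag_apply, Matrix.mul_single_apply_of_ne _ _ _ _ _ hp]
    · simp
  simp [this]
  ring

lemma apb_herm_trace {n : Type*} [Fintype n] (H : Matrix n n ℂ) (hH : H.IsHermitian) :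
    0 ≤ ((H * H).trace).re := by
  rw [Matrix.trace, Complex.re_sum]
  refine Finset.sum_nonneg fun i _ => ?_
  rw [Matrix.diag_apply, Matrix.mul_apply, Complex.re_sum]
  refine Finset.sum_nonneg fun j _ => ?_
  rw [← hH.apply j i]
  simp only [Complex.star_def, Complex.mul_conj, Complex.ofReal_re]
  exact Complex.normSq_nonneg _

lemma apb_final {R A : Type*} [Fintype R] [Fintype A] [DecidableEq A]
    (ρ : Matrix (R × A) (R × A) ℂ) (β γ : ℂ) :
    ∑ t : R × R × A × A × A × A,
      ρ (t.1, t.2.2.1) (t.2.1, t.2.2.2.1) * ρ (t.2.1, t.2.2.2.2.1) (t.1, t.2.2.2.2.2) *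
      ((if t.2.2.2.1 = t.2.2.1 ∧ t.2.2.2.2.2 = t.2.2.2.2.1 then β else 0) +
        (if t.2.2.2.1 = t.2.2.2.2.1 ∧ t.2.2.2.2.2 = t.2.2.1 then γ else 0)) =
    β * (ptraceA ρ * ptraceA ρ).trace + γ * (ρ * ρ).trace := by
  have h1 : (ptraceA ρ * ptraceA ρ).trace =
      ∑ r, ∑ s, ∑ a, ∑ b, ρ (r, a) (s, a) * ρ (s, b) (r, b) := by
    simp only [Matrix.trace, Matrix.diag_apply, Matrix.mul_apply, ptraceA, Matrix.of_apply,
      Finset.sum_mul_sum]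
  have h2 : (ρ * ρ).trace =
      ∑ r, ∑ s, ∑ a, ∑ a', ρ (r, a) (s, a') * ρ (s, a') (r, a) := by
    simp only [Matrix.trace, Matrix.diag_apply, Matrix.mul_apply, Fintype.sum_prod_type]
    exact Finset.sum_congr rfl fun r _ => Finset.sum_comm
  rw [h1, h2]
  simp only [Finset.mul_sum]
  simp only [← Finset.sum_add_distrib, Fintype.sum_prod_type]
  refine Finset.sum_congr rfl fun r _ => Finset.sum_congr rfl fun s _ =>
    Finset.sum_congr rfl fun a _ => ?_
  simp only [mul_add, Finset.sum_add_distrib]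
  congr 1
  · rw [Finset.sum_eq_single a]
    · refine Finset.sum_congr rfl fun b _ => ?_
      simp [mul_comm]
    · intro a' _ h
      simp [h]
    · simp
  · refine Finset.sum_congr rfl fun a' _ => ?_
    rw [Finset.sum_eq_single a']
    · simp [mul_comm]
    · intro b _ h
      simp [h.symm]
    · simp


/-- **Averaged-purity bound** at the heart of the decoupling theorem:
`∫ tr(σ(U)²) dμ ≤ tr(ρ_R²)/d₂ + tr(ρ²)/d₁`, where `σ(U)` is the reduced state on
`R × A₂` of the Haar-randomized state `(1_R ⊗ U) ρ (1_R ⊗ U)ᴴ`. -/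
theorem averaged_purity_bound
    (R A₁ A₂ : Type) [Fintype R] [Fintype A₁] [Fintype A₂]
    [DecidableEq R] [DecidableEq A₁] [DecidableEq A₂]
    [Nonempty R] [Nonempty A₁] [Nonempty A₂]
    (hd : 2 ≤ Fintype.card A₁ * Fintype.card A₂)
    (ρ : Matrix (R × (A₁ × A₂)) (R × (A₁ × A₂)) ℂ) (hρ : ρ.PosSemidef)
    (μ : Measure (Matrix.unitaryGroup (A₁ × A₂) ℂ))
    [μ.IsHaarMeasure] [IsProbabilityMeasure μ] :
    ∫ U : Matrix.unitaryGroup (A₁ × A₂) ℂ,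
        ((ptraceA₁ (((1 : Matrix R R ℂ) ⊗ₖ (U : Matrix (A₁ × A₂) (A₁ × A₂) ℂ)) * ρ *
              ((1 : Matrix R R ℂ) ⊗ₖ (U : Matrix (A₁ × A₂) (A₁ × A₂) ℂ))ᴴ) *
            ptraceA₁ (((1 : Matrix R R ℂ) ⊗ₖ (U : Matrix (A₁ × A₂) (A₁ × A₂) ℂ)) * ρ *
              ((1 : Matrix R R ℂ) ⊗ₖ (U : Matrix (A₁ × A₂) (A₁ × A₂) ℂ))ᴴ)).trace).re ∂μ
      ≤ (1 / (Fintype.card A₂ : ℝ)) * ((ptraceA ρ * ptraceA ρ).trace).re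
        + (1 / (Fintype.card A₁ : ℝ)) * ((ρ * ρ).trace).re := by
  have hnt : Nontrivial (A₁ × A₂) := by
    rw [← Fintype.one_lt_card_iff_nontrivial, Fintype.card_prod]
    omega
  obtain ⟨β, γ, hX⟩ := apb_commutant (apbX μ) (apbX_comm μ)
  -- the two trace equations
  have ht1 := apbX_trace μ 1 (fun V => by rw [Matrix.mul_one, Matrix.one_mul])
  have ht2 := apbX_trace μ (apbF (A₁ × A₂)) apbF_kron
  rw [apbW_trace] at ht1
  rw [apbFW_trace] at ht2
  have hs1 : (1 * apbX μ).trace = β * ((Fintype.card A₁ : ℂ) * Fintype.card A₂) ^ 2 +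
      γ * ((Fintype.card A₁ : ℂ) * Fintype.card A₂) := by
    rw [Matrix.one_mul, Matrix.trace, Fintype.sum_prod_type]
    simp only [Matrix.diag_apply, hX]
    have : ∀ a b : A₁ × A₂, (a = b ∧ b = a) ↔ a = b := fun a b =>
      ⟨fun h => h.1, fun h => ⟨h, h.symm⟩⟩
    simp only [this, and_self, if_true, Finset.sum_add_distrib, Finset.sum_ite_eq,
      Finset.mem_univ, Finset.sum_const, Finset.card_univ, Fintype.card_prod, nsmul_eq_mul]
    push_cast
    ring
  have hs2 : (apbF (A₁ × A₂) * apbX μ).trace =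
      β * ((Fintype.card A₁ : ℂ) * Fintype.card A₂) +
      γ * ((Fintype.card A₁ : ℂ) * Fintype.card A₂) ^ 2 := by
    have h0 : ∀ a b : A₁ × A₂, (apbF (A₁ × A₂) * apbX μ) (a, b) (a, b) =
        apbX μ (b, a) (a, b) := by
      intro a b
      rw [Matrix.mul_apply, Finset.sum_eq_single (b, a)]
      · simp [apbF]
      · intro p _ hp
        simp [apbF, hp]
      · simp
    rw [Matrix.trace, Fintype.sum_prod_type]
    simp only [Matrix.diag_apply, h0, hX]
    have : ∀ a b : A₁ × A₂, (b = a ∧ a = b) ↔ a = b := fun a b =>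
      ⟨fun h => h.2, fun h => ⟨h.symm, h⟩⟩
    simp only [this, and_self, if_true, Finset.sum_add_distrib, Finset.sum_ite_eq,
      Finset.mem_univ, Finset.sum_const, Finset.card_univ, Fintype.card_prod, nsmul_eq_mul]
    push_cast
    ring
  rw [hs1] at ht1
  rw [hs2] at ht2
  -- the integral
  have hcont : ∀ t : R × R × (A₁ × A₂) × (A₁ × A₂) × (A₁ × A₂) × (A₁ × A₂),
      Integrable (fun U : Matrix.unitaryGroup (A₁ × A₂) ℂ =>
        ρ (t.1, t.2.2.1) (t.2.1, t.2.2.2.1) * ρ (t.2.1, t.2.2.2.2.1) (t.1, t.2.2.2.2.2) *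
        apbG (U : Matrix (A₁ × A₂) (A₁ × A₂) ℂ)
          (t.2.2.2.1, t.2.2.2.2.2) (t.2.2.1, t.2.2.2.2.1)) μ :=
    fun t => (apb_integrable μ _ (apbG_continuous _ _)).const_mul _
  have hint : ∫ U : Matrix.unitaryGroup (A₁ × A₂) ℂ,
      (∑ t : R × R × (A₁ × A₂) × (A₁ × A₂) × (A₁ × A₂) × (A₁ × A₂),
        ρ (t.1, t.2.2.1) (t.2.1, t.2.2.2.1) * ρ (t.2.1, t.2.2.2.2.1) (t.1, t.2.2.2.2.2) *
        apbG (U : Matrix (A₁ × A₂) (A₁ × A₂) ℂ)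
          (t.2.2.2.1, t.2.2.2.2.2) (t.2.2.1, t.2.2.2.2.1)) ∂μ =
      β * (ptraceA ρ * ptraceA ρ).trace + γ * (ρ * ρ).trace := by
    rw [integral_finsetSum _ fun t _ => hcont t]
    have h1 : ∀ t : R × R × (A₁ × A₂) × (A₁ × A₂) × (A₁ × A₂) × (A₁ × A₂),
        ∫ U : Matrix.unitaryGroup (A₁ × A₂) ℂ,
          ρ (t.1, t.2.2.1) (t.2.1, t.2.2.2.1) * ρ (t.2.1, t.2.2.2.2.1) (t.1, t.2.2.2.2.2) *
          apbG (U : Matrix (A₁ × A₂) (A₁ × A₂) ℂ)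
            (t.2.2.2.1, t.2.2.2.2.2) (t.2.2.1, t.2.2.2.2.1) ∂μ =
        ρ (t.1, t.2.2.1) (t.2.1, t.2.2.2.1) * ρ (t.2.1, t.2.2.2.2.1) (t.1, t.2.2.2.2.2) *
          apbX μ (t.2.2.2.1, t.2.2.2.2.2) (t.2.2.1, t.2.2.2.2.1) := by
      intro t
      rw [integral_const_mul]
      rfl
    simp only [h1, hX]
    exact apb_final ρ β γ
  have hre : ∀ f : Matrix.unitaryGroup (A₁ × A₂) ℂ → ℂ, Integrable f μ →
      ∫ U, (f U).re ∂μ = (∫ U, f U ∂μ).re := fun f hf => integral_re hf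
  simp only [apb_trace]
  rw [hre _ (integrable_finsetSum _ fun t _ => hcont t), hint]
  -- nonnegativity
  have hT2 : 0 ≤ ((ρ * ρ).trace).re := apb_herm_trace ρ hρ.isHermitian
  have hT1 : 0 ≤ ((ptraceA ρ * ptraceA ρ).trace).re := by
    apply apb_herm_trace
    ext r r'
    simp only [Matrix.conjTranspose_apply, ptraceA, Matrix.of_apply, star_sum]
    exact Finset.sum_congr rfl fun a _ => hρ.isHermitian.apply _ _
  -- solve
  set m : ℝ := (Fintype.card A₁ : ℝ) with hm
  set n : ℝ := (Fintype.card A₂ : ℝ) with hn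
  have hm1 : 1 ≤ m := by rw [hm]; exact_mod_cast Fintype.card_pos
  have hn1 : 1 ≤ n := by rw [hn]; exact_mod_cast Fintype.card_pos
  have hmn : 2 ≤ m * n := by rw [hm, hn]; exact_mod_cast hd
  have cm : (Fintype.card A₁ : ℂ) = (m : ℂ) := by simp [hm]
  have cn : (Fintype.card A₂ : ℂ) = (n : ℂ) := by simp [hn]
  rw [cm, cn] at ht1 ht2
  have hD : 0 < (m * n) ^ 2 - 1 := by nlinarith
  have hm0 : (m : ℂ) ≠ 0 := by exact_mod_cast (by linarith : m ≠ 0)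
  have hn0 : (n : ℂ) ≠ 0 := by exact_mod_cast (by linarith : n ≠ 0)
  have hD0 : ((m : ℂ) * n) ^ 2 - 1 ≠ 0 := by exact_mod_cast hD.ne'
  have e1 : β * (m * n) + γ = m := by
    apply mul_left_cancel₀ (mul_ne_zero hm0 hn0)
    linear_combination ht1
  have e2 : β + γ * (m * n) = n := by
    apply mul_left_cancel₀ (mul_ne_zero hm0 hn0)
    linear_combination ht2
  have hβ : β = (((m * (m * n) - n) / ((m * n) ^ 2 - 1) : ℝ) : ℂ) := by
    push_cast
    rw [eq_div_iff hD0]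
    linear_combination (m * n : ℂ) * e1 - e2
  have hγ : γ = (((n * (m * n) - m) / ((m * n) ^ 2 - 1) : ℝ) : ℂ) := by
    push_cast
    rw [eq_div_iff hD0]
    linear_combination (m * n : ℂ) * e2 - e1
  rw [hβ, hγ, Complex.add_re, Complex.re_ofReal_mul, Complex.re_ofReal_mul]
  have b1 : (m * (m * n) - n) / ((m * n) ^ 2 - 1) ≤ 1 / n := by
    rw [div_le_div_iff₀ hD (by linarith)]
    nlinarith
  have b2 : (n * (m * n) - m) / ((m * n) ^ 2 - 1) ≤ 1 / m := by
    rw [div_le_div_iff₀ hD (by linarith)]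
    nlinarith
  exact add_le_add (mul_le_mul_of_nonneg_right b1 hT1) (mul_le_mul_of_nonneg_right b2 hT2)
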